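/- Let u, v : ℝ³ ∖ {0} → ℝ be smooth and homogeneous of degree 0. Then for every k ∈ {1,2,3}, ∫_{S²} x_k ⟨x, ∇(Δu)(x) × ∇v(x)⟩ dS = ∫_{S²} x_k ⟨x, ∇u(x) × ∇(Δv)(x)⟩ dS, where Δ is the ambient Euclidean Laplacian. (This realizes the integration-by-parts formula ∫_{S²} X̃^k ε^{AB}∇_A(Δ_{S²}u)∇_B v = ∫_{S²} X̃^k ε^{AB}∇_A u ∇_B(Δ_{S²}v) on the round sphere.) -/

import Mathlib

open MeasureTheory Matrix

noncomputable section

/-- Euclidean 3-space. -/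
abbrev E3 := EuclideanSpace ℝ (Fin 3)

/-- The Euclidean inner product on coordinate vectors. -/
def dot3 (a b : Fin 3 → ℝ) : ℝ := ∑ i, a i * b i

/-- The cross product in ℝ³. -/
def cross3 (a b : Fin 3 → ℝ) : Fin 3 → ℝ :=
  ![a 1 * b 2 - a 2 * b 1, a 2 * b 0 - a 0 * b 2, a 0 * b 1 - a 1 * b 0]

/-- Standard basis vectors of E3. -/
def e3 (i : Fin 3) : E3 := EuclideanSpace.single i 1

/-- The ambient gradient of `u : ℝ³ → ℝ` (as a coordinate vector). -/
def grad3 (u : E3 → ℝ) (x : E3) : Fin 3 → ℝ := fun i => fderiv ℝ u x (e3 i)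

/-- The ambient Hessian matrix of `u : ℝ³ → ℝ`. -/
def hess3 (u : E3 → ℝ) (x : E3) : Matrix (Fin 3) (Fin 3) ℝ :=
  Matrix.of fun i j => iteratedFDeriv ℝ 2 u x ![e3 i, e3 j]

/-- The ambient Euclidean Laplacian Δu = Σᵢ ∂²u/∂xᵢ². -/
def lap3 (u : E3 → ℝ) : E3 → ℝ := fun x => ∑ i, hess3 u x i i

/-- The orthogonal projection P(x) = I - x xᵀ onto the tangent plane of S² at x. -/
def proj3 (x : E3) : Matrix (Fin 3) (Fin 3) ℝ := 1 - Matrix.of fun i j => x i * x j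

/-- The projected ambient Hessian H_u(x) = P(x) (D²u)(x) P(x), realizing the intrinsic
Hessian on S² of the restriction of a degree-0 homogeneous function. -/
def hessS (u : E3 → ℝ) (x : E3) : Matrix (Fin 3) (Fin 3) ℝ := proj3 x * hess3 u x * proj3 x

/-- The matrix of the linear map `w ↦ x × w` on ℝ³. -/
def crossMat (x : E3) : Matrix (Fin 3) (Fin 3) ℝ :=
  !![0, -x 2, x 1; x 2, 0, -x 0; -x 1, x 0, 0]

/-- `u` is (positively) homogeneous of degree 0 away from the origin. -/
def Homog0 (u : E3 → ℝ) : Prop := ∀ c : ℝ, 0 < c → ∀ x : E3, x ≠ 0 → u (c • x) = u x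

/-- The derivative of `f` along the linear vector field `A`. -/
def linDeriv (A : E3 →L[ℝ] E3) (f : E3 → ℝ) (x : E3) : ℝ := fderiv ℝ f x (A x)

/-- The generator `x ↦ eᵢ × x` of the rotations about the `i`-th axis. -/
def rotGen (i : Fin 3) : E3 →L[ℝ] E3 :=
  (EuclideanSpace.proj (i + 1) : E3 →L[ℝ] ℝ).smulRight (e3 (i + 2)) -
    (EuclideanSpace.proj (i + 2) : E3 →L[ℝ] ℝ).smulRight (e3 (i + 1))

/-- The sum of the squares of the rotation generators. -/
def casimir (f : E3 → ℝ) (x : E3) : ℝ := ∑ m, linDeriv (rotGen m) (linDeriv (rotGen m) f) x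

/-- Smoothness away from the origin. -/
abbrev SmoothOffZero {F : Type*} [NormedAddCommGroup F] [NormedSpace ℝ F] (f : E3 → F) : Prop :=
  ContDiffOn ℝ (⊤ : ℕ∞) f {(0 : E3)}ᶜ

lemma rotGen_apply (i : Fin 3) (x : E3) :
    rotGen i x = x (i + 1) • e3 (i + 2) - x (i + 2) • e3 (i + 1) := by
  simp [rotGen]

lemma eq_sum_e3 (x : E3) : x = ∑ i, x i • e3 i := by
  ext j
  fin_cases j <;> simp [e3, Fin.sum_univ_three]

namespace SmoothOffZero

variable {F : Type*} [NormedAddCommGroup F] [NormedSpace ℝ F]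

lemma contDiffAt {f : E3 → F} (hf : SmoothOffZero f) {x : E3} (hx : x ≠ 0) :
    ContDiffAt ℝ (⊤ : ℕ∞) f x :=
  ContDiffOn.contDiffAt hf (isOpen_compl_singleton.mem_nhds hx)

lemma differentiableAt {f : E3 → F} (hf : SmoothOffZero f) {x : E3} (hx : x ≠ 0) :
    DifferentiableAt ℝ f x :=
  (hf.contDiffAt hx).differentiableAt (by simp)

lemma fderiv {f : E3 → F} (hf : SmoothOffZero f) : SmoothOffZero (fderiv ℝ f) :=
  ContDiffOn.fderiv_of_isOpen hf isOpen_compl_singleton (by exact_mod_cast le_rfl)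

lemma linDeriv {f : E3 → ℝ} (hf : SmoothOffZero f) (A : E3 →L[ℝ] E3) :
    SmoothOffZero (linDeriv A f) :=
  ContDiffOn.clm_apply hf.fderiv A.contDiff.contDiffOn

lemma casimir {f : E3 → ℝ} (hf : SmoothOffZero f) : SmoothOffZero (casimir f) :=
  ContDiffOn.sum fun m _ => SmoothOffZero.linDeriv (SmoothOffZero.linDeriv hf (rotGen m)) (rotGen m)

end SmoothOffZero

lemma linDeriv_congr {f g : E3 → ℝ} (A : E3 →L[ℝ] E3) (h : ∀ x ≠ 0, f x = g x) {x : E3}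
    (hx : x ≠ 0) : linDeriv A f x = linDeriv A g x := by
  have : f =ᶠ[nhds x] g := by
    filter_upwards [isOpen_compl_singleton.mem_nhds hx] with y hy using h y hy
  rw [linDeriv, linDeriv, this.fderiv_eq]

lemma linDeriv_add {f g : E3 → ℝ} (hf : SmoothOffZero f) (hg : SmoothOffZero g)
    (A : E3 →L[ℝ] E3) {x : E3} (hx : x ≠ 0) :
    linDeriv A (fun y => f y + g y) x = linDeriv A f x + linDeriv A g x := by
  rw [linDeriv, fderiv_fun_add (hf.differentiableAt hx) (hg.differentiableAt hx)]
  rfl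

lemma linDeriv_sub {f g : E3 → ℝ} (hf : SmoothOffZero f) (hg : SmoothOffZero g)
    (A : E3 →L[ℝ] E3) {x : E3} (hx : x ≠ 0) :
    linDeriv A (fun y => f y - g y) x = linDeriv A f x - linDeriv A g x := by
  rw [linDeriv, fderiv_fun_sub (hf.differentiableAt hx) (hg.differentiableAt hx)]
  rfl

lemma linDeriv_mul {f g : E3 → ℝ} (hf : SmoothOffZero f) (hg : SmoothOffZero g)
    (A : E3 →L[ℝ] E3) {x : E3} (hx : x ≠ 0) :
    linDeriv A (fun y => f y * g y) x = linDeriv A f x * g x + f x * linDeriv A g x := by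
  rw [linDeriv, fderiv_fun_mul (hf.differentiableAt hx) (hg.differentiableAt hx)]
  simp [linDeriv]
  ring

lemma linDeriv_linDeriv {f : E3 → ℝ} (hf : SmoothOffZero f) (A B : E3 →L[ℝ] E3) {x : E3}
    (hx : x ≠ 0) :
    linDeriv A (linDeriv B f) x =
      fderiv ℝ (fderiv ℝ f) x (A x) (B x) + fderiv ℝ f x (B (A x)) := by
  have h := (hf.fderiv.differentiableAt hx).hasFDerivAt.clm_apply (B.hasFDerivAt (x := x))
  have h' : fderiv ℝ (linDeriv B f) x = _ := h.fderiv
  rw [linDeriv, h']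
  simp [add_comm]

lemma linDeriv_commutator {f : E3 → ℝ} (hf : SmoothOffZero f) (A B : E3 →L[ℝ] E3) {x : E3}
    (hx : x ≠ 0) :
    linDeriv A (linDeriv B f) x - linDeriv B (linDeriv A f) x =
      fderiv ℝ f x (B (A x) - A (B x)) := by
  have hs : IsSymmSndFDerivAt ℝ f x :=
    (hf.contDiffAt hx).isSymmSndFDerivAt (by
      rw [minSmoothness_of_isRCLikeNormedField]
      exact WithTop.coe_le_coe.2 (le_top : (2 : ℕ∞) ≤ ⊤))
  rw [linDeriv_linDeriv hf A B hx, linDeriv_linDeriv hf B A hx, hs.eq (A x) (B x), map_sub]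
  ring

lemma rotGen_commutator (i : Fin 3) (x : E3) :
    rotGen i (rotGen (i + 1) x) - rotGen (i + 1) (rotGen i x) = rotGen (i + 2) x := by
  ext j
  fin_cases i <;> fin_cases j <;> simp [rotGen_apply, e3]

lemma linDeriv_rotGen_commutator {f : E3 → ℝ} (hf : SmoothOffZero f) (i : Fin 3) {x : E3}
    (hx : x ≠ 0) :
    linDeriv (rotGen (i + 1)) (linDeriv (rotGen i) f) x =
      linDeriv (rotGen i) (linDeriv (rotGen (i + 1)) f) x + linDeriv (rotGen (i + 2)) f x := by
  have h := linDeriv_commutator hf (rotGen (i + 1)) (rotGen i) hx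
  rw [rotGen_commutator] at h
  rw [← sub_eq_iff_eq_add', h, linDeriv]

lemma casimir_eq (f : E3 → ℝ) (i : Fin 3) (x : E3) :
    casimir f x = linDeriv (rotGen i) (linDeriv (rotGen i) f) x +
      linDeriv (rotGen (i + 1)) (linDeriv (rotGen (i + 1)) f) x +
      linDeriv (rotGen (i + 2)) (linDeriv (rotGen (i + 2)) f) x := by
  fin_cases i <;> simp [casimir, Fin.sum_univ_three] <;> ring

lemma casimir_linDeriv {f : E3 → ℝ} (hf : SmoothOffZero f) (i : Fin 3) {x : E3} (hx : x ≠ 0) :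
    casimir (linDeriv (rotGen i) f) x = linDeriv (rotGen i) (casimir f) x := by
  have hL (j : Fin 3) := hf.linDeriv (rotGen j)
  have hLL (j k : Fin 3) := (hL j).linDeriv (rotGen k)
  have e1 : i + 2 + 1 = i := by rw [add_assoc]; exact add_zero i
  have e2 : i + 2 + 2 = i + 1 := by rw [add_assoc]; rfl
  have hb := linDeriv_congr (rotGen (i + 1))
    (fun y hy => linDeriv_rotGen_commutator hf i (x := y) hy) hx
  rw [linDeriv_add (hLL _ _) (hL _) _ hx, linDeriv_rotGen_commutator (hL _) i hx] at hb
  have hc := linDeriv_congr (rotGen (i + 2))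
    (f := linDeriv (rotGen (i + 2)) (linDeriv (rotGen i) f)) (g := fun y =>
      linDeriv (rotGen i) (linDeriv (rotGen (i + 2)) f) y - linDeriv (rotGen (i + 1)) f y)
    (fun y hy => by
      have := linDeriv_rotGen_commutator hf (i + 2) (x := y) hy
      rw [e1, e2] at this
      linarith) hx
  have hc' := linDeriv_rotGen_commutator (hL (i + 2)) (i + 2) hx
  rw [e1, e2] at hc'
  rw [linDeriv_sub (hLL _ _) (hL _) _ hx] at hc
  have hr := linDeriv_congr (rotGen i) (fun y _ => casimir_eq f i y) hx
  rw [linDeriv_add ((hLL _ _).add (hLL _ _)) (hLL _ _) _ hx,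
    linDeriv_add (hLL _ _) (hLL _ _) _ hx] at hr
  rw [hr, casimir_eq _ i]
  linarith

lemma Homog0.fderiv_apply_self {u : E3 → ℝ} (hu0 : Homog0 u) (hu : SmoothOffZero u) {x : E3}
    (hx : x ≠ 0) : fderiv ℝ u x x = 0 := by
  have hc : HasDerivAt (fun c : ℝ => c • x) x 1 := by
    simpa using (hasDerivAt_id (1 : ℝ)).smul_const x
  have hd : HasFDerivAt u (fderiv ℝ u x) ((1 : ℝ) • x) := by
    rw [one_smul]; exact (hu.differentiableAt hx).hasFDerivAt
  have h1 := hd.comp_hasDerivAt (1 : ℝ) hc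
  refine h1.unique ((hasDerivAt_const (1 : ℝ) (u x)).congr_of_eventuallyEq ?_)
  filter_upwards [lt_mem_nhds (zero_lt_one (α := ℝ))] with c hc using hu0 c hc x hx

lemma casimir_eq_lap3 {u : E3 → ℝ} (hu : SmoothOffZero u) (hu0 : Homog0 u) {x : E3}
    (hx : x ≠ 0) : casimir u x = ‖x‖ ^ 2 * lap3 u x := by
  have h1 := hu0.fderiv_apply_self hu hx
  have h2 : fderiv ℝ (fderiv ℝ u) x x x = 0 := by
    have h := linDeriv_linDeriv hu (.id ℝ E3) (.id ℝ E3) hx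
    rw [linDeriv_congr (f := linDeriv (.id ℝ E3) u) (g := fun _ => 0) _
      (fun y hy => hu0.fderiv_apply_self hu hy) hx] at h
    simpa [linDeriv, h1] using h.symm
  have hn : ‖x‖ ^ 2 = x 0 ^ 2 + x 1 ^ 2 + x 2 ^ 2 := by
    simp [EuclideanSpace.norm_sq_eq, Fin.sum_univ_three]
  have hJ : ∑ m, rotGen m (rotGen m x) = -(2 : ℝ) • x := by
    ext j
    fin_cases j <;> simp [rotGen_apply, e3, Fin.sum_univ_three] <;> ring
  have h3 : ∑ m, fderiv ℝ u x (rotGen m (rotGen m x)) = 0 := by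
    rw [← map_sum, hJ, map_smul, h1, smul_zero]
  have h4 : ∑ m, fderiv ℝ (fderiv ℝ u) x (rotGen m x) (rotGen m x) =
      ‖x‖ ^ 2 * lap3 u x - fderiv ℝ (fderiv ℝ u) x x x := by
    have hxx : fderiv ℝ (fderiv ℝ u) x x x =
        fderiv ℝ (fderiv ℝ u) x (∑ i, x i • e3 i) (∑ i, x i • e3 i) := by
      rw [← eq_sum_e3]
    rw [hxx, hn]
    simp only [lap3, hess3, Matrix.of_apply, iteratedFDeriv_two_apply, Fin.sum_univ_three,
      rotGen_apply, map_add, map_sub, map_smul, _root_.add_apply, _root_.sub_apply,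
      _root_.smul_apply, smul_eq_mul]
    simp
    ring
  simp only [casimir, linDeriv_linDeriv hu _ _ hx, Finset.sum_add_distrib]
  rw [h3, h4, h2]
  ring

lemma lap3_smoothOffZero {u : E3 → ℝ} (hu : SmoothOffZero u) : SmoothOffZero (lap3 u) := by
  have h : lap3 u = fun x => ∑ i, fderiv ℝ (fderiv ℝ u) x (e3 i) (e3 i) := by
    ext x
    simp [lap3, hess3, iteratedFDeriv_two_apply]
  rw [h]
  exact ContDiffOn.sum fun i _ =>
    (hu.fderiv.fderiv.clm_apply contDiffOn_const).clm_apply contDiffOn_const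

lemma linDeriv_norm_sq (i : Fin 3) (x : E3) : linDeriv (rotGen i) (fun y => ‖y‖ ^ 2) x = 0 := by
  rw [linDeriv, (hasStrictFDerivAt_norm_sq x).hasFDerivAt.fderiv]
  fin_cases i <;> simp [rotGen_apply, e3, inner_sub_right, inner_smul_right,
    EuclideanSpace.inner_single_right] <;> ring

lemma linDeriv_lap3 {u : E3 → ℝ} (hu : SmoothOffZero u) (hu0 : Homog0 u) (i : Fin 3) {x : E3}
    (hx : ‖x‖ = 1) :
    linDeriv (rotGen i) (lap3 u) x = casimir (linDeriv (rotGen i) u) x := by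
  have hx0 : x ≠ 0 := by rintro rfl; simp at hx
  rw [casimir_linDeriv hu i hx0,
    linDeriv_congr _ (fun y hy => casimir_eq_lap3 hu hu0 (x := y) hy) hx0,
    linDeriv_mul (contDiff_norm_sq ℝ).contDiffOn (lap3_smoothOffZero hu) _ hx0, linDeriv_norm_sq, hx]
  ring

lemma coord_mul_bracket (f g : E3 → ℝ) (x : E3) (k : Fin 3) :
    x k * dot3 (fun i => x i) (cross3 (grad3 f x) (grad3 g x)) =
      linDeriv (rotGen (k + 1)) f x * linDeriv (rotGen (k + 2)) g x -
      linDeriv (rotGen (k + 2)) f x * linDeriv (rotGen (k + 1)) g x := by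
  fin_cases k <;>
  · simp [linDeriv, rotGen_apply, dot3, cross3, grad3, Fin.sum_univ_three]
    ring

/-- The rotation by the angle `t` about the `i`-th axis. -/
def axisRot (i : Fin 3) (t : ℝ) : E3 →L[ℝ] E3 :=
  .id ℝ E3 + Real.sin t • rotGen i + (1 - Real.cos t) • (rotGen i).comp (rotGen i)

lemma axisRot_apply (i : Fin 3) (t : ℝ) (x : E3) :
    axisRot i t x = x + Real.sin t • rotGen i x + (1 - Real.cos t) • rotGen i (rotGen i x) := rfl

lemma norm_axisRot (i : Fin 3) (t : ℝ) (x : E3) : ‖axisRot i t x‖ = ‖x‖ := by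
  rw [← sq_eq_sq₀ (norm_nonneg _) (norm_nonneg _)]
  have h := Real.sin_sq_add_cos_sq t
  simp only [EuclideanSpace.norm_sq_eq, Fin.sum_univ_three, axisRot_apply, rotGen_apply, e3]
  fin_cases i <;> simp
  · linear_combination (x 1 ^ 2 + x 2 ^ 2) * h
  · linear_combination (x 0 ^ 2 + x 2 ^ 2) * h
  · linear_combination (x 0 ^ 2 + x 1 ^ 2) * h

lemma rotGen_axisRot (i : Fin 3) (t : ℝ) (x : E3) :
    rotGen i (axisRot i t x) =
      Real.cos t • rotGen i x + Real.sin t • rotGen i (rotGen i x) := by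
  ext j
  simp only [axisRot_apply, rotGen_apply, e3]
  fin_cases i <;> fin_cases j <;> simp <;> ring

lemma hasDerivAt_axisRot (i : Fin 3) (t : ℝ) (x : E3) :
    HasDerivAt (fun s => axisRot i s x) (rotGen i (axisRot i t x)) t := by
  rw [rotGen_axisRot]
  have h := (((Real.hasDerivAt_sin t).smul_const (rotGen i x)).const_add x).add
    (((Real.hasDerivAt_cos t).const_sub 1).smul_const (rotGen i (rotGen i x)))
  rw [neg_neg] at h
  exact h

lemma setIntegral_sphere_comp_axisRot (f : E3 → ℝ) (i : Fin 3) (t : ℝ) :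
    ∫ x in Metric.sphere (0 : E3) 1, f (axisRot i t x) ∂(μH[2]) =
      ∫ x in Metric.sphere (0 : E3) 1, f x ∂(μH[2]) := by
  let R : E3 →ₗᵢ[ℝ] E3 := ⟨(axisRot i t).toLinearMap, norm_axisRot i t⟩
  let e := (R.toLinearIsometryEquiv rfl).toIsometryEquiv
  have h := (e.measurePreserving_hausdorffMeasure 2).setIntegral_preimage_emb
    e.toHomeomorph.measurableEmbedding f (Metric.sphere 0 1)
  have hs : e ⁻¹' Metric.sphere 0 1 = Metric.sphere 0 1 := by
    ext x
    simp [e]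
  rwa [hs] at h

lemma hausdorffMeasure_sphere_lt_top :
    μH[2] (Metric.sphere (0 : E3) 1) < ⊤ := by
  let φ : ℝ × ℝ → E3 := fun p =>
    !₂[Real.cos p.2 * Real.cos p.1, Real.cos p.2 * Real.sin p.1, Real.sin p.2]
  have hφ : ContDiff ℝ 1 φ := by
    rw [contDiff_euclidean]
    intro j
    fin_cases j <;> simp [φ] <;> fun_prop
  set s : Set (ℝ × ℝ) := Set.Icc (-Real.pi) Real.pi ×ˢ Set.Icc (-Real.pi) Real.pi
  have hs : IsCompact s := isCompact_Icc.prod isCompact_Icc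
  obtain ⟨K, hK⟩ :=
    (hφ.locallyLipschitz.locallyLipschitzOn (s := s)).exists_lipschitzOnWith_of_compact hs
  have hsub : Metric.sphere (0 : E3) 1 ⊆ φ '' s := by
    intro x hx
    have hn : x 0 ^ 2 + x 1 ^ 2 + x 2 ^ 2 = 1 := by
      have : ‖x‖ ^ 2 = 1 := by simp [mem_sphere_zero_iff_norm.1 hx]
      simpa [EuclideanSpace.norm_sq_eq, Fin.sum_univ_three] using this
    set z : ℂ := ⟨x 0, x 1⟩
    have hz : Real.cos (Real.arcsin (x 2)) = ‖z‖ := by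
      rw [Real.cos_arcsin, Complex.norm_def, Complex.normSq_apply]
      congr 1
      simp only [z]
      linarith
    have hpi := Real.pi_pos
    refine ⟨(z.arg, Real.arcsin (x 2)), ⟨⟨(Complex.neg_pi_lt_arg z).le, Complex.arg_le_pi z⟩,
      by linarith [Real.neg_pi_div_two_le_arcsin (x 2)],
      by linarith [Real.arcsin_le_pi_div_two (x 2)]⟩, ?_⟩
    ext j
    fin_cases j
    · simp [φ, hz, Complex.norm_mul_cos_arg, z]
    · simp [φ, hz, Complex.norm_mul_sin_arg, z]
    · simpa [φ] using Real.sin_arcsin (x := x 2) (by nlinarith) (by nlinarith)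
  calc μH[2] (Metric.sphere (0 : E3) 1) ≤ μH[2] (φ '' s) := measure_mono hsub
    _ ≤ (K : ENNReal) ^ (2 : ℝ) * μH[2] s := hK.hausdorffMeasure_image_le (by norm_num)
    _ < ⊤ := by
      rw [hausdorffMeasure_prod_real]
      exact ENNReal.mul_lt_top (by simp) hs.measure_lt_top

lemma ne_zero_of_mem_sphere_one {x : E3} (hx : x ∈ Metric.sphere (0 : E3) 1) : x ≠ 0 :=
  ne_zero_of_mem_unit_sphere ⟨x, hx⟩

lemma SmoothOffZero.continuousOn_sphere {f : E3 → ℝ} (hf : SmoothOffZero f) :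
    ContinuousOn f (Metric.sphere (0 : E3) 1) :=
  (ContDiffOn.continuousOn hf).mono fun _ hx => ne_zero_of_mem_sphere_one hx

lemma integrableOn_sphere {f : E3 → ℝ} (hf : ContinuousOn f (Metric.sphere (0 : E3) 1)) :
    IntegrableOn f (Metric.sphere (0 : E3) 1) μH[2] :=
  hf.integrableOn_of_subset_isCompact (isCompact_sphere 0 1) Metric.isClosed_sphere.measurableSet
    subset_rfl hausdorffMeasure_sphere_lt_top.ne

/-- Rotation invariance of the surface measure in infinitesimal form. -/
lemma setIntegral_sphere_linDeriv_rotGen {f : E3 → ℝ} (hf : SmoothOffZero f) (i : Fin 3) :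
    ∫ x in Metric.sphere (0 : E3) 1, linDeriv (rotGen i) f x ∂(μH[2]) = 0 := by
  have hmem (t : ℝ) : Set.MapsTo (axisRot i t) (Metric.sphere (0 : E3) 1) (Metric.sphere 0 1) :=
    fun x hx => by simpa [norm_axisRot] using hx
  have hc (t : ℝ) {g : E3 → ℝ} (hg : SmoothOffZero g) :
      ContinuousOn (fun x => g (axisRot i t x)) (Metric.sphere (0 : E3) 1) :=
    hg.continuousOn_sphere.comp (axisRot i t).continuous.continuousOn (hmem t)
  have hf' := hf.linDeriv (rotGen i)
  obtain ⟨C, hC⟩ := (isCompact_sphere (0 : E3) 1).exists_bound_of_continuousOn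
    hf'.continuousOn_sphere
  have hms : MeasurableSet (Metric.sphere (0 : E3) 1) := Metric.isClosed_sphere.measurableSet
  have h := (hasDerivAt_integral_of_dominated_loc_of_deriv_le
    (μ := (μH[2]).restrict (Metric.sphere (0 : E3) 1)) (x₀ := (0 : ℝ)) (s := Set.univ)
    (F := fun t x => f (axisRot i t x)) (F' := fun t x => linDeriv (rotGen i) f (axisRot i t x))
    (bound := fun _ => C) Filter.univ_mem
    (.of_forall fun t => (hc t hf).aestronglyMeasurable hms) (integrableOn_sphere (hc 0 hf))
    ((hc 0 hf').aestronglyMeasurable hms)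
    ((ae_restrict_mem hms).mono fun x hx t _ => hC _ (hmem t hx))
    (integrableOn_sphere continuousOn_const)
    ((ae_restrict_mem hms).mono fun x hx t _ =>
      (hf.differentiableAt (ne_zero_of_mem_sphere_one (hmem t hx))).hasFDerivAt.comp_hasDerivAt t
        (hasDerivAt_axisRot i t x))).2
  simp only [setIntegral_sphere_comp_axisRot] at h
  exact h.unique (hasDerivAt_const _ _)

lemma SmoothOffZero.mul {f g : E3 → ℝ} (hf : SmoothOffZero f) (hg : SmoothOffZero g) :
    SmoothOffZero fun x => f x * g x :=
  ContDiffOn.mul hf hg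

lemma SmoothOffZero.sub {f g : E3 → ℝ} (hf : SmoothOffZero f) (hg : SmoothOffZero g) :
    SmoothOffZero fun x => f x - g x :=
  ContDiffOn.sub hf hg

/-- Green's second identity on the unit sphere. -/
lemma setIntegral_sphere_casimir_mul {f g : E3 → ℝ} (hf : SmoothOffZero f)
    (hg : SmoothOffZero g) :
    ∫ x in Metric.sphere (0 : E3) 1, casimir f x * g x ∂(μH[2]) =
      ∫ x in Metric.sphere (0 : E3) 1, f x * casimir g x ∂(μH[2]) := by
  have hfm (m : Fin 3) := hf.linDeriv (rotGen m)
  have hgm (m : Fin 3) := hg.linDeriv (rotGen m)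
  have hw (m : Fin 3) := ((hfm m).mul hg).sub (hf.mul (hgm m))
  rw [← sub_eq_zero, ← integral_sub (integrableOn_sphere (hf.casimir.mul hg).continuousOn_sphere)
    (integrableOn_sphere (hf.mul hg.casimir).continuousOn_sphere)]
  calc _ = ∫ x in Metric.sphere (0 : E3) 1, ∑ m, linDeriv (rotGen m)
        (fun y => linDeriv (rotGen m) f y * g y - f y * linDeriv (rotGen m) g y) x ∂(μH[2]) := by
        refine setIntegral_congr_fun Metric.isClosed_sphere.measurableSet fun x hx => ?_
        have hx0 := ne_zero_of_mem_sphere_one hx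
        simp only [casimir, Finset.sum_mul, Finset.mul_sum, ← Finset.sum_sub_distrib]
        refine Finset.sum_congr rfl fun m _ => ?_
        rw [linDeriv_sub ((hfm m).mul hg) (hf.mul (hgm m)) _ hx0, linDeriv_mul (hfm m) hg _ hx0,
          linDeriv_mul hf (hgm m) _ hx0]
        ring
    _ = 0 := by
        rw [integral_finsetSum _ fun m _ =>
          integrableOn_sphere ((hw m).linDeriv (rotGen m)).continuousOn_sphere]
        exact Finset.sum_eq_zero fun m _ => setIntegral_sphere_linDeriv_rotGen (hw m) m

/-- for smooth degree-0 homogeneous u, v on ℝ³∖{0} and each k,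
∫_{S²} x_k ⟨x, ∇(Δu) × ∇v⟩ dS = ∫_{S²} x_k ⟨x, ∇u × ∇(Δv)⟩ dS. -/
theorem integral_bracket_laplacian_symm (u v : E3 → ℝ)
    (hu : ContDiffOn ℝ (⊤ : ℕ∞) u {(0:E3)}ᶜ) (hv : ContDiffOn ℝ (⊤ : ℕ∞) v {(0:E3)}ᶜ)
    (hu0 : Homog0 u) (hv0 : Homog0 v) (k : Fin 3) :
    ∫ x in Metric.sphere (0:E3) 1,
        x k * dot3 (fun i => x i) (cross3 (grad3 (lap3 u) x) (grad3 v x)) ∂(μH[2]) =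
    ∫ x in Metric.sphere (0:E3) 1,
        x k * dot3 (fun i => x i) (cross3 (grad3 u x) (grad3 (lap3 v) x)) ∂(μH[2]) := by
  have hs : MeasurableSet (Metric.sphere (0 : E3) 1) := Metric.isClosed_sphere.measurableSet
  have hum (m : Fin 3) : SmoothOffZero (linDeriv (rotGen m) u) := SmoothOffZero.linDeriv hu _
  have hvm (m : Fin 3) : SmoothOffZero (linDeriv (rotGen m) v) := SmoothOffZero.linDeriv hv _
  simp only [coord_mul_bracket]
  rw [setIntegral_congr_fun hs (g := fun x =>
      casimir (linDeriv (rotGen (k + 1)) u) x * linDeriv (rotGen (k + 2)) v x -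
      casimir (linDeriv (rotGen (k + 2)) u) x * linDeriv (rotGen (k + 1)) v x) fun x hx => by
      simp only [linDeriv_lap3 hu hu0 _ (mem_sphere_zero_iff_norm.1 hx)],
    setIntegral_congr_fun hs (f := fun x =>
      linDeriv (rotGen (k + 1)) u x * linDeriv (rotGen (k + 2)) (lap3 v) x -
      linDeriv (rotGen (k + 2)) u x * linDeriv (rotGen (k + 1)) (lap3 v) x) (g := fun x =>
      linDeriv (rotGen (k + 1)) u x * casimir (linDeriv (rotGen (k + 2)) v) x -
      linDeriv (rotGen (k + 2)) u x * casimir (linDeriv (rotGen (k + 1)) v) x) fun x hx => by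
      simp only [linDeriv_lap3 hv hv0 _ (mem_sphere_zero_iff_norm.1 hx)],
    integral_sub (integrableOn_sphere ((hum _).casimir.mul (hvm _)).continuousOn_sphere)
      (integrableOn_sphere ((hum _).casimir.mul (hvm _)).continuousOn_sphere),
    integral_sub (integrableOn_sphere ((hum _).mul (hvm _).casimir).continuousOn_sphere)
      (integrableOn_sphere ((hum _).mul (hvm _).casimir).continuousOn_sphere),
    setIntegral_sphere_casimir_mul (hum _) (hvm _), setIntegral_sphere_casimir_mul (hum _) (hvm _)]
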